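/- Regularity of generalized Hermite extensions: for integers λ ≥ 1 and μ ≥ 1, the Wronskian W(H_λ, H_{λ+1}, …, H_{λ+μ−1}) of the μ consecutive Hermite polynomials H_λ, …, H_{λ+μ−1} has no real zeros if and only if μ is even. -/

import Mathlib

/-- The physicists' Hermite polynomials:
`H₀ = 1`, `H₁ = 2x`, `H_{n+1} = 2x·H_n − 2n·H_{n-1}`. -/
noncomputable def hermiteH : ℕ → Polynomial ℝ
  | 0 => 1
  | 1 => Polynomial.C 2 * Polynomial.X
  | n + 2 => Polynomial.C 2 * Polynomial.X * hermiteH (n + 1)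
      - Polynomial.C (2 * ((n : ℝ) + 1)) * hermiteH n

/-- The Wronskian of a list of functions: the determinant of the matrix whose
`(i, j)` entry is the `i`-th derivative of the `j`-th function (0-indexed);
the empty Wronskian is `1`. -/
noncomputable def wronskian (fs : List (ℝ → ℝ)) (z : ℝ) : ℝ :=
  Matrix.det (Matrix.of fun i j : Fin fs.length => iteratedDeriv i.val (fs.get j) z)


section HermiteWronskian

open Polynomial Filter Topology MeasureTheory

/-- The derivatives of the Hermite polynomials form an Appell-type sequence. -/
theorem derivative_hermiteH_succ (n : ℕ) :
    derivative (hermiteH (n + 1)) = C (2 * ((n : ℝ) + 1)) * hermiteH n := by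
  induction n using Nat.twoStepInduction with
  | zero => simp [hermiteH]
  | one =>
    simp only [hermiteH, derivative_sub, derivative_mul, derivative_X,
      C_mul, C_add, C_1, map_ofNat, Nat.cast_one, Nat.cast_zero, C_0, derivative_one,
      derivative_add, derivative_zero, derivative_ofNat]
    ring
  | more n ih1 ih2 =>
    rw [hermiteH, derivative_sub, derivative_mul, derivative_mul, derivative_mul, ih2, ih1]
    simp only [derivative_C, derivative_X]
    rw [hermiteH]
    push_cast
    simp only [C_mul, C_add, C_1, map_ofNat]
    ring

theorem hermiteH_succ (n : ℕ) :
    hermiteH (n + 1) = C 2 * X * hermiteH n - derivative (hermiteH n) := by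
  cases n with
  | zero => simp [hermiteH]
  | succ n => rw [derivative_hermiteH_succ, hermiteH]

theorem degree_hermiteH (n : ℕ) : (hermiteH n).degree = n := by
  induction n with
  | zero => simp [hermiteH]
  | succ n ih =>
    have h0 : hermiteH n ≠ 0 := by
      rintro h
      simp [h] at ih
    have h1 : (C 2 * X * hermiteH n).degree = ((n + 1 : ℕ) : WithBot ℕ) := by
      rw [degree_mul, degree_C_mul_X (by norm_num), ih, add_comm]
      rfl
    rw [hermiteH_succ, degree_sub_eq_left_of_degree_lt, h1]
    rw [h1]
    refine (degree_derivative_lt h0).trans ?_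
    rw [ih]
    exact_mod_cast Nat.lt_succ_self n

/-- The Hermite polynomials as a polynomial sequence. -/
noncomputable def hermiteHSequence : Polynomial.Sequence ℝ := ⟨hermiteH, degree_hermiteH⟩

theorem linearIndependent_hermiteH : LinearIndependent ℝ hermiteH :=
  hermiteHSequence.linearIndependent

theorem integrable_eval_mul_exp_neg_sq (p : ℝ[X]) :
    Integrable fun x : ℝ => p.eval x * Real.exp (-x ^ 2) := by
  induction p using Polynomial.induction_on' with
  | add p q hp hq =>
    simp only [eval_add, add_mul]
    exact hp.add hq
  | monomial n a =>
    have h := (integrable_rpow_mul_exp_neg_mul_sq (b := 1) one_pos (s := n)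
      (by linarith [n.cast_nonneg (α := ℝ)])).const_mul a
    simpa [mul_assoc] using h

/-- Hermite polynomials are orthogonal to polynomials of smaller degree. -/
theorem integral_hermiteH_mul_eq_zero (n : ℕ) (p : ℝ[X]) (hp : p.degree < n) :
    ∫ x : ℝ, (hermiteH n * p).eval x * Real.exp (-x ^ 2) = 0 := by
  induction n generalizing p with
  | zero =>
    have : p = 0 := by simpa using hp
    simp [this]
  | succ n ih =>
    have hd : (derivative p).degree < n := by
      by_cases h0 : p = 0
      · simp [h0]
      · have h1 := degree_derivative_lt h0
        rw [degree_eq_natDegree h0] at hp h1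
        refine h1.trans_le ?_
        exact_mod_cast Nat.lt_succ_iff.mp (by exact_mod_cast hp)
    have hder : ∀ x : ℝ, HasDerivAt
        (fun x => (hermiteH n * p).eval x * Real.exp (-x ^ 2))
        ((hermiteH n * derivative p - hermiteH (n + 1) * p).eval x * Real.exp (-x ^ 2)) x := by
      intro x
      have h := ((hermiteH n * p).hasDerivAt x).mul ((hasDerivAt_pow 2 x).neg.exp)
      refine h.congr_deriv ?_
      rw [hermiteH_succ]
      simp
      ring
    have h := integral_eq_zero_of_hasDerivAt_of_integrable hder
      (integrable_eval_mul_exp_neg_sq _) (integrable_eval_mul_exp_neg_sq _)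
    simp only [eval_sub, sub_mul] at h
    rw [integral_sub (integrable_eval_mul_exp_neg_sq _) (integrable_eval_mul_exp_neg_sq _),
      ih _ hd] at h
    linarith

/-- The matrix of derivatives of Hermite polynomials with degrees `n j`. -/
noncomputable def hermiteJet {k : ℕ} (n : Fin k → ℕ) (z : ℝ) : Matrix (Fin k) (Fin k) ℝ :=
  Matrix.of fun i j => (derivative^[i] (hermiteH (n j))).eval z

/-- A polynomial whose square times an even power of `X - z` has zero Gaussian integral vanishes. -/
theorem eq_zero_of_integral_pow_mul_sq_eq_zero {k : ℕ} (hk : Even k) (z : ℝ) (r : ℝ[X])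
    (h : ∫ x : ℝ, ((X - C z) ^ k * r * r).eval x * Real.exp (-x ^ 2) = 0) : r = 0 := by
  have hnn : 0 ≤ fun x : ℝ => ((X - C z) ^ k * r * r).eval x * Real.exp (-x ^ 2) := by
    intro x
    have h1 : 0 ≤ (x - z) ^ k := hk.pow_nonneg _
    have h2 := mul_nonneg h1 (mul_self_nonneg (r.eval x))
    have : ((X - C z) ^ k * r * r).eval x = (x - z) ^ k * (r.eval x * r.eval x) := by
      simp [mul_assoc]
    simp only [Pi.zero_apply, this]
    positivity
  rw [integral_eq_zero_iff_of_nonneg hnn (integrable_eval_mul_exp_neg_sq _)] at h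
  have hc : Continuous fun x : ℝ => ((X - C z) ^ k * r * r).eval x * Real.exp (-x ^ 2) := by
    fun_prop
  have h' := (Continuous.ae_eq_iff_eq volume hc continuous_zero).mp h
  have hz : (X - C z) ^ k * r * r = 0 := by
    refine Polynomial.funext fun x => ?_
    have := congrFun h' x
    simpa [Real.exp_ne_zero] using this
  have hX : (X - C z) ^ k ≠ 0 := pow_ne_zero _ (X_sub_C_ne_zero z)
  simpa [hX] using hz

/-- The Wronskian of an even number of consecutive Hermite polynomials has no real zero. -/
theorem det_hermiteJet_ne_zero {k : ℕ} (hk : Even k) (a : ℕ) (z : ℝ) :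
    (hermiteJet (fun j : Fin k => a + j) z).det ≠ 0 := by
  intro hdet
  obtain ⟨c, hc, hMc⟩ := Matrix.exists_mulVec_eq_zero_iff.mpr hdet
  set q : ℝ[X] := ∑ j : Fin k, c j • hermiteH (a + j) with hq
  have hq0 : q ≠ 0 := by
    intro h
    have hinj : Function.Injective fun j : Fin k => a + (j : ℕ) := fun i j hij => by
      ext
      simpa using hij
    exact hc (funext (Fintype.linearIndependent_iff.mp
      (linearIndependent_hermiteH.comp _ hinj) c h))
  have hroot : ∀ i < k, (derivative^[i] q).IsRoot z := by
    intro i hi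
    have := congrFun hMc ⟨i, hi⟩
    rw [IsRoot, hq, iterate_derivative_sum, eval_finsetSum]
    simpa [Matrix.mulVec, dotProduct, hermiteJet, iterate_derivative_smul, mul_comm] using this
  have hmult : k ≤ q.rootMultiplicity z := by
    rcases k with _ | k
    · exact Nat.zero_le _
    · exact lt_rootMultiplicity_of_isRoot_iterate_derivative hq0
        fun m hm => hroot m (Nat.lt_succ_of_le hm)
  obtain ⟨r, hr⟩ := (le_rootMultiplicity_iff hq0).mp hmult
  have hr0 : r ≠ 0 := by
    rintro rfl
    simp [hr] at hq0
  have hqd : q.degree < ((a + k : ℕ) : WithBot ℕ) := by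
    refine (degree_sum_le _ _).trans_lt ?_
    rw [Finset.sup_lt_iff (WithBot.bot_lt_coe _)]
    intro j _
    refine (degree_smul_le _ _).trans_lt ?_
    rw [degree_hermiteH]
    exact_mod_cast Nat.add_lt_add_left j.2 a
  have hrd : r.degree < a := by
    rw [hr, degree_mul, degree_pow, degree_X_sub_C, nsmul_one, degree_eq_natDegree hr0] at hqd
    rw [degree_eq_natDegree hr0]
    have : k + r.natDegree < a + k := by exact_mod_cast hqd
    exact_mod_cast (by omega : r.natDegree < a)
  refine hr0 (eq_zero_of_integral_pow_mul_sq_eq_zero hk z r ?_)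
  rw [← hr, hq]
  simp only [Finset.sum_mul, eval_finsetSum]
  rw [integral_finsetSum _ fun j _ => integrable_eval_mul_exp_neg_sq _]
  refine Finset.sum_eq_zero fun j _ => ?_
  simp only [smul_mul_assoc, eval_smul, smul_eq_mul, mul_assoc (c j)]
  rw [integral_const_mul, integral_hermiteH_mul_eq_zero _ _ ?_, mul_zero]
  refine hrd.trans_le ?_
  exact_mod_cast Nat.le_add_right _ _

theorem iterate_derivative_hermiteH (n i : ℕ) :
    derivative^[i] (hermiteH n) = C (2 ^ i * (n.descFactorial i : ℝ)) * hermiteH (n - i) := by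
  induction i with
  | zero => simp
  | succ i ih =>
    rw [Function.iterate_succ_apply', ih, derivative_C_mul, Nat.descFactorial_succ]
    rcases Nat.lt_or_ge i n with h | h
    · obtain ⟨m, rfl⟩ := Nat.exists_eq_add_of_lt h
      have h1 : i + m + 1 - i = m + 1 := by omega
      have h2 : i + m + 1 - (i + 1) = m := by omega
      rw [h1, h2, derivative_hermiteH_succ, ← mul_assoc, ← C_mul]
      congr 2
      push_cast
      ring
    · have h1 : n - i = 0 := by omega
      simp [h1, hermiteH]

theorem tendsto_hermiteH_div_pow (n : ℕ) :
    Tendsto (fun x : ℝ => (hermiteH n).eval x * (x ^ n)⁻¹) (Bornology.cobounded ℝ)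
      (𝓝 (2 ^ n)) := by
  have hne : ∀ᶠ x : ℝ in Bornology.cobounded ℝ, x ≠ 0 := Bornology.eventually_ne_cobounded 0
  induction n using Nat.twoStepInduction with
  | zero => simp [hermiteH]
  | one =>
    refine tendsto_const_nhds.congr' ?_
    filter_upwards [hne] with x hx
    simp [hermiteH, hx]
  | more n ih1 ih2 =>
    have hinv := (tendsto_inv₀_cobounded (α := ℝ)).pow 2
    have h := (ih2.const_mul 2).sub ((ih1.const_mul (2 * ((n : ℝ) + 1))).mul hinv)
    have h' : 2 * 2 ^ (n + 1) - 2 * ((n : ℝ) + 1) * 2 ^ n * 0 ^ 2 = 2 ^ (n + 2) := by ring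
    rw [h'] at h
    refine h.congr' ?_
    filter_upwards [hne] with x hx
    simp only [hermiteH, eval_sub, eval_mul, eval_C, eval_X]
    field_simp
    ring

theorem tendsto_iterate_derivative_hermiteH (n i : ℕ) :
    Tendsto (fun x : ℝ => (x ^ n)⁻¹ * (x ^ i * (derivative^[i] (hermiteH n)).eval x))
      (Bornology.cobounded ℝ) (𝓝 (2 ^ n * n.descFactorial i)) := by
  simp only [iterate_derivative_hermiteH, eval_mul, eval_C]
  rcases Nat.lt_or_ge n i with h | h
  · simp [Nat.descFactorial_eq_zero_iff_lt.mpr h]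
  · obtain ⟨m, rfl⟩ := Nat.exists_eq_add_of_le h
    have ht := (tendsto_hermiteH_div_pow m).const_mul
      (2 ^ i * ((i + m).descFactorial i : ℝ))
    have h' : 2 ^ i * ((i + m).descFactorial i : ℝ) * 2 ^ m
        = 2 ^ (i + m) * ((i + m).descFactorial i : ℝ) := by ring
    rw [h'] at ht
    refine ht.congr' ?_
    filter_upwards [Bornology.eventually_ne_cobounded (0 : ℝ)] with x hx
    rw [Nat.add_sub_cancel_left]
    field_simp
    ring

/-- Leading asymptotics of the determinant of Hermite derivatives. -/
theorem tendsto_det_hermiteJet {k : ℕ} (n : Fin k → ℕ) :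
    Tendsto (fun x : ℝ => (∏ j, (x ^ n j)⁻¹) * ((∏ i : Fin k, x ^ (i : ℕ)) *
        (hermiteJet n x).det)) (Bornology.cobounded ℝ)
      (𝓝 ((Matrix.of fun i j : Fin k =>
        (2 : ℝ) ^ n j * ((n j).descFactorial i : ℝ)).det)) := by
  have hc : Continuous fun A : Matrix (Fin k) (Fin k) ℝ => A.det :=
    continuous_id.matrix_det
  have hdet : ∀ x : ℝ, (∏ j, (x ^ n j)⁻¹) * ((∏ i : Fin k, x ^ (i : ℕ)) * (hermiteJet n x).det)
      = (Matrix.of fun i j : Fin k => (x ^ n j)⁻¹ *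
          Matrix.of (fun i j : Fin k => x ^ (i : ℕ) * hermiteJet n x i j) i j).det := fun x => by
    rw [Matrix.det_mul_row, Matrix.det_mul_column]
  simp only [hdet]
  refine (hc.tendsto _).comp ?_
  refine tendsto_pi_nhds.mpr fun i => tendsto_pi_nhds.mpr fun j => ?_
  exact tendsto_iterate_derivative_hermiteH (n j) i

theorem det_two_pow_mul_descFactorial_ne_zero {k : ℕ} (n : Fin k → ℕ)
    (hn : Function.Injective n) :
    (Matrix.of fun i j : Fin k => (2 : ℝ) ^ n j * ((n j).descFactorial i : ℝ)).det ≠ 0 := by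
  have h := Matrix.det_eval_matrixOfPolynomials_eq_det_vandermonde
    (fun j => (n j : ℝ)) (fun i : Fin k => descPochhammer ℝ i)
    (fun i => descPochhammer_natDegree ℝ i) (fun i => monic_descPochhammer ℝ i)
  simp only [descPochhammer_eval_eq_descFactorial] at h
  rw [← Matrix.det_transpose] at h
  have h2 := Matrix.det_mul_row (fun j => (2 : ℝ) ^ n j)
    (Matrix.of fun i j : Fin k => ((n j).descFactorial i : ℝ))
  simp only [Matrix.of_apply] at h2
  rw [h2]
  refine mul_ne_zero (Finset.prod_ne_zero_iff.mpr fun j _ => by positivity) ?_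
  rw [← Matrix.det_transpose]
  have hv : (Matrix.vandermonde fun j => (n j : ℝ)).det ≠ 0 :=
    Matrix.det_vandermonde_ne_zero_iff.mpr (Nat.cast_injective.comp hn)
  rw [← Matrix.det_transpose, h] at hv
  exact hv

theorem differentiable_det_hermiteJet {k : ℕ} (n : Fin k → ℕ) :
    Differentiable ℝ fun z => (hermiteJet n z).det := by
  have h : (fun z => (hermiteJet n z).det) = fun z =>
      (Matrix.of fun i j : Fin k => derivative^[i] (hermiteH (n j))).det.eval z := by
    funext z
    exact ((evalRingHom z).map_det _).symm
  rw [h]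
  exact Polynomial.differentiable _

/-- A differentiable function on the line with the same limit at both ends has a critical point. -/
theorem exists_deriv_eq_zero_of_tendsto_cobounded {f : ℝ → ℝ} {l : ℝ} (hf : Differentiable ℝ f)
    (h : Tendsto f (Bornology.cobounded ℝ) (𝓝 l)) : ∃ z, deriv f z = 0 := by
  by_contra! hd
  have hinj : Function.Injective f := by
    intro a b hab
    by_contra hne
    rcases lt_or_gt_of_ne hne with hlt | hlt
    · obtain ⟨c, -, hc⟩ := exists_deriv_eq_zero hlt hf.continuous.continuousOn hab
      exact hd c hc
    · obtain ⟨c, -, hc⟩ := exists_deriv_eq_zero hlt hf.continuous.continuousOn hab.symm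
      exact hd c hc
  rw [IsOrderBornology.cobounded_eq, tendsto_sup] at h
  rcases hf.continuous.strictMono_of_inj hinj with hm | hm
  · have h0 := hm.monotone.le_of_tendsto h.1 0
    have h1 := hm.monotone.ge_of_tendsto h.2 1
    have := hm (zero_lt_one (α := ℝ))
    linarith
  · have h0 := hm.antitone.ge_of_tendsto h.1 0
    have h1 := hm.antitone.le_of_tendsto h.2 1
    have := hm (zero_lt_one (α := ℝ))
    linarith

/-- The coefficients, by Cramer's rule, expressing the jet of `H_a` at `z` through those of
`H_{n j}`. -/
noncomputable def hermiteCoeff {k : ℕ} (a : ℕ) (n : Fin k → ℕ) (j : Fin k) (z : ℝ) : ℝ :=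
  (hermiteJet (Function.update n j a) z).det / (hermiteJet n z).det

theorem sum_hermiteJet_mul_hermiteCoeff {k : ℕ} (a : ℕ) (n : Fin k → ℕ) (z : ℝ)
    (hz : (hermiteJet n z).det ≠ 0) (i : Fin k) :
    ∑ j, (derivative^[i] (hermiteH (n j))).eval z * hermiteCoeff a n j z
      = (derivative^[i] (hermiteH a)).eval z := by
  set b : Fin k → ℝ := fun i => (derivative^[i] (hermiteH a)).eval z with hb
  have hupd : ∀ j, (hermiteJet n z).updateCol j b = hermiteJet (Function.update n j a) z := by
    intro j
    ext i j'
    by_cases hj : j' = j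
    · subst hj
      simp [hermiteJet, hb]
    · simp [hermiteJet, hj]
  have h := congrFun (Matrix.mulVec_cramer (hermiteJet n z) b) i
  simp only [Matrix.mulVec, dotProduct, Matrix.cramer_apply, hupd, Pi.smul_apply,
    smul_eq_mul] at h
  rw [← mul_right_inj' hz]
  refine Eq.trans ?_ h
  rw [Finset.mul_sum]
  refine Finset.sum_congr rfl fun j _ => ?_
  rw [hermiteCoeff, hermiteJet, Matrix.of_apply]
  rw [hermiteJet] at hz
  field_simp

theorem differentiable_hermiteCoeff {k : ℕ} (a : ℕ) (n : Fin k → ℕ) (j : Fin k)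
    (h : ∀ z, (hermiteJet n z).det ≠ 0) : Differentiable ℝ (hermiteCoeff a n j) :=
  (differentiable_det_hermiteJet _).div (differentiable_det_hermiteJet n) h

theorem tendsto_hermiteCoeff {k : ℕ} (a : ℕ) (n : Fin k → ℕ) (hn : Function.Injective n)
    (j : Fin k) (haj : a < n j) :
    Tendsto (hermiteCoeff a n j) (Bornology.cobounded ℝ) (𝓝 0) := by
  obtain ⟨d, hd⟩ := Nat.exists_eq_add_of_lt haj
  have h := (((tendsto_det_hermiteJet (Function.update n j a)).div (tendsto_det_hermiteJet n)
    (det_two_pow_mul_descFactorial_ne_zero n hn))).mul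
      ((tendsto_inv₀_cobounded (α := ℝ)).pow (d + 1))
  rw [zero_pow (Nat.succ_ne_zero d), mul_zero] at h
  refine h.congr' ?_
  filter_upwards [Bornology.eventually_ne_cobounded (0 : ℝ)] with x hx
  have hP : (∏ i : Fin k, x ^ (i : ℕ)) ≠ 0 :=
    Finset.prod_ne_zero_iff.mpr fun i _ => pow_ne_zero _ hx
  have hQ : ∏ i ∈ Finset.univ.erase j, (x ^ n i)⁻¹ ≠ 0 :=
    Finset.prod_ne_zero_iff.mpr fun i _ => inv_ne_zero (pow_ne_zero _ hx)
  have h1 : ∏ i, (x ^ Function.update n j a i)⁻¹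
      = (x ^ a)⁻¹ * ∏ i ∈ Finset.univ.erase j, (x ^ n i)⁻¹ := by
    rw [← Finset.mul_prod_erase _ _ (Finset.mem_univ j), Function.update_self]
    congr 1
    refine Finset.prod_congr rfl fun i hi => ?_
    rw [Function.update_of_ne (Finset.ne_of_mem_erase hi)]
  rw [Pi.div_apply, h1, ← Finset.mul_prod_erase _ (fun i => (x ^ n i)⁻¹) (Finset.mem_univ j), hd,
    hermiteCoeff]
  generalize (hermiteJet n x).det = w
  generalize (hermiteJet (Function.update n j a) x).det = v
  generalize ∏ i ∈ Finset.univ.erase j, (x ^ n i)⁻¹ = Q at *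
  generalize ∏ i : Fin k, x ^ (i : ℕ) = P at *
  by_cases hw : w = 0
  · simp [hw]
  · field_simp
    rw [one_div, inv_pow]
    field_simp
    ring

/-- The Wronskian of an odd number of consecutive Hermite polynomials of positive degree has a
real zero. -/
theorem exists_det_hermiteJet_eq_zero {m : ℕ} (hm : Even m) (a : ℕ) :
    ∃ z, (hermiteJet (fun j : Fin (m + 1) => a + 1 + j) z).det = 0 := by
  by_contra! hW
  set n : Fin (m + 1) → ℕ := fun j => a + 1 + j with hn
  have hinj : Function.Injective n := fun i j hij => by
    ext
    simpa [hn] using hij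
  set c := hermiteCoeff a n with hc
  have hcd : ∀ j, Differentiable ℝ (c j) := fun j => differentiable_hermiteCoeff a n j hW
  obtain ⟨z, hz⟩ := exists_deriv_eq_zero_of_tendsto_cobounded (hcd (Fin.last m))
    (tendsto_hermiteCoeff a n hinj (Fin.last m) (by simp [hn]; omega))
  have hsum : ∀ (i : Fin (m + 1)) (x : ℝ),
      ∑ j, (derivative^[i] (hermiteH (n j))).eval x * c j x
        = (derivative^[i] (hermiteH a)).eval x :=
    fun i x => sum_hermiteJet_mul_hermiteCoeff a n x (hW x) i
  have hder : ∀ i : Fin (m + 1),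
      ∑ j, (derivative^[i + 1] (hermiteH (n j))).eval z * c j z
        + ∑ j, (derivative^[i] (hermiteH (n j))).eval z * deriv (c j) z
        = (derivative^[i + 1] (hermiteH a)).eval z := by
    intro i
    have h1 : HasDerivAt
        (fun x => ∑ j, (derivative^[i] (hermiteH (n j))).eval x * c j x)
        (∑ j, ((derivative (derivative^[i] (hermiteH (n j)))).eval z * c j z
          + (derivative^[i] (hermiteH (n j))).eval z * deriv (c j) z)) z :=
      HasDerivAt.fun_sum fun j _ =>
        (Polynomial.hasDerivAt _ z).mul (hcd j z).hasDerivAt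
    rw [funext (hsum i)] at h1
    have h2 := h1.unique (Polynomial.hasDerivAt _ z)
    simpa only [Function.iterate_succ_apply', Finset.sum_add_distrib] using h2
  have hzero : ∀ i : Fin m,
      ∑ j, (derivative^[i] (hermiteH (n j))).eval z * deriv (c j) z = 0 := by
    intro i
    have h1 := hder i.castSucc
    have h2 := hsum i.succ z
    simp only [Fin.val_castSucc, Fin.val_succ] at h1 h2
    linarith
  have hc' : ∀ j, deriv (c j) z = 0 := by
    have hker : (fun j : Fin m => deriv (c j.castSucc) z) = 0 := by
      refine Matrix.eq_zero_of_mulVec_eq_zero (det_hermiteJet_ne_zero hm (a + 1) z) ?_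
      funext i
      have := hzero i
      rw [Fin.sum_univ_castSucc, hz, mul_zero, add_zero] at this
      simpa [Matrix.mulVec, dotProduct, hermiteJet, hn] using this
    intro j
    induction j using Fin.lastCases with
    | last => exact hz
    | cast j => exact congrFun hker j
  have hlast := hder (Fin.last m)
  simp only [hc', mul_zero, Finset.sum_const_zero, add_zero, Fin.val_last] at hlast
  have hall : ∀ i : Fin (m + 1 + 1), ∑ j, (derivative^[i] (hermiteH (n j))).eval z * c j z
      = (derivative^[i] (hermiteH a)).eval z := by
    intro i
    induction i using Fin.lastCases with
    | last => simpa using hlast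
    | cast i => exact hsum i z
  have hker := Matrix.eq_zero_of_mulVec_eq_zero
    (det_hermiteJet_ne_zero (k := m + 1 + 1) (hm.add even_two) a z)
    (v := Fin.cons (-1) fun j => c j z) (by
      funext i
      have h := hall i
      simp only [Matrix.mulVec, dotProduct, hermiteJet, Matrix.of_apply]
      rw [Fin.sum_univ_succ]
      simp only [Fin.cons_zero, Fin.cons_succ, Fin.val_zero, Fin.val_succ, add_zero,
        Pi.zero_apply]
      simp only [hn, add_assoc, add_comm 1] at h
      linarith)
  simpa using congrFun hker 0

theorem iteratedDeriv_eval (p : ℝ[X]) (i : ℕ) :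
    iteratedDeriv i (fun x => p.eval x) = fun x => (derivative^[i] p).eval x := by
  induction i with
  | zero => simp
  | succ i ih =>
    rw [iteratedDeriv_succ, ih, Function.iterate_succ_apply']
    funext x
    exact Polynomial.deriv _

theorem wronskian_hermiteH (lam mu : ℕ) (z : ℝ) :
    wronskian ((List.range mu).map fun i => fun x => (hermiteH (lam + i)).eval x) z
      = (hermiteJet (fun j : Fin mu => lam + j) z).det := by
  have hlen : mu = ((List.range mu).map
      fun i => fun x => (hermiteH (lam + i)).eval x).length := by simp
  rw [_root_.wronskian, ← Matrix.det_submatrix_equiv_self (finCongr hlen)]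
  congr 1
  ext i j
  simp [hermiteJet, iteratedDeriv_eval]

end HermiteWronskian

/-- regularity of generalized Hermite extensions: for `λ, μ ≥ 1`, the
Wronskian `W(H_λ, H_{λ+1}, …, H_{λ+μ−1})` of `μ` consecutive Hermite polynomials has
no real zeros if and only if `μ` is even. -/
theorem generalized_hermite_wronskian_regular_iff (lam mu : ℕ) (hlam : 1 ≤ lam)
    (hmu : 1 ≤ mu) :
    (∀ z : ℝ,
        wronskian ((List.range mu).map fun i => fun x => (hermiteH (lam + i)).eval x) z ≠ 0)
      ↔ Even mu := by
  simp only [wronskian_hermiteH]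
  refine ⟨fun h => ?_, fun h z => det_hermiteJet_ne_zero h lam z⟩
  by_contra hodd
  obtain ⟨m, rfl⟩ := Nat.exists_eq_add_of_le' hmu
  obtain ⟨a, rfl⟩ := Nat.exists_eq_add_of_le' hlam
  have hm : Even m := by
    rw [Nat.even_add_one, not_not] at hodd
    exact hodd
  obtain ⟨z, hz⟩ := exists_det_hermiteJet_eq_zero hm a
  exact h z hz
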